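/- arXiv:2405.15634 — 2 statements merged into one kernel-verified Lean document; each statement's English description precedes it below -/
import Mathlib

section
/- Corollary 1.5: Set A′_1 := MSG(S_1) ∖ {a_n}, for each s ∈ ℕ let sA′_1 denote the s-fold sumset of A′_1 (with 0A′_1 := {0}), let Ap_1^{(s)} := Ap_1 ∩ sA′_1, and let N := max{s ∈ ℕ : Ap_1^{(s)} ≠ ∅}. Then the poset (Ap_1, ≤_1) is graded if and only if Σ_{s=0}^{N} |Ap_1^{(s)}| = d. -/
/-- The Apery set of a submonoid `S ⊆ ℕ` with respect to `d`:
elements `y ∈ S` such that `y - d ∉ S`. -/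
def AperyN (S : AddSubmonoid ℕ) (d : ℕ) : Set ℕ :=
  {y | y ∈ S ∧ ¬ ∃ s ∈ S, y = s + d}

/-- The Apery set of a submonoid `S ⊆ ℕ × ℕ` with respect to `(0,d)` and `(d,0)`. -/
def AperyP (S : AddSubmonoid (ℕ × ℕ)) (d : ℕ) : Set (ℕ × ℕ) :=
  {y | y ∈ S ∧ (¬ ∃ s ∈ S, y = s + ((0 : ℕ), d)) ∧ (¬ ∃ s ∈ S, y = s + (d, (0 : ℕ)))}

/-- The partial order induced by a submonoid of `ℕ`. -/
def leN (S : AddSubmonoid ℕ) (y z : ℕ) : Prop := ∃ s ∈ S, z = y + s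

/-- The partial order induced by a submonoid of `ℕ × ℕ`. -/
def leP (S : AddSubmonoid (ℕ × ℕ)) (y z : ℕ × ℕ) : Prop := ∃ s ∈ S, z = y + s

/-- The numerical semigroup `S₁` generated by `a 1, …, a n`. -/
def Smon1 (n : ℕ) (a : ℕ → ℕ) : AddSubmonoid ℕ :=
  AddSubmonoid.closure {x | ∃ i, 1 ≤ i ∧ i ≤ n ∧ x = a i}

/-- The numerical semigroup `S₂` generated by `d - a 0, …, d - a (n-1)`. -/
def Smon2 (n d : ℕ) (a : ℕ → ℕ) : AddSubmonoid ℕ :=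
  AddSubmonoid.closure {x | ∃ i, i < n ∧ x = d - a i}

/-- The monoid `S ⊆ ℕ × ℕ` generated by the `(a i, d - a i)`, `i = 0, …, n`. -/
def SmonH (n d : ℕ) (a : ℕ → ℕ) : AddSubmonoid (ℕ × ℕ) :=
  AddSubmonoid.closure {p | ∃ i, i ≤ n ∧ p = (a i, d - a i)}

/-- `z` covers `y` in the poset `(AperyN S d, leN S)`. -/
def coversN (S : AddSubmonoid ℕ) (d : ℕ) (y z : ℕ) : Prop :=
  y ∈ AperyN S d ∧ z ∈ AperyN S d ∧ (leN S y z ∧ y ≠ z) ∧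
    ¬ ∃ w ∈ AperyN S d, (leN S y w ∧ y ≠ w) ∧ (leN S w z ∧ w ≠ z)

/-- `z` covers `y` in the poset `(AperyP S d, leP S)`. -/
def coversP (S : AddSubmonoid (ℕ × ℕ)) (d : ℕ) (y z : ℕ × ℕ) : Prop :=
  y ∈ AperyP S d ∧ z ∈ AperyP S d ∧ (leP S y z ∧ y ≠ z) ∧
    ¬ ∃ w ∈ AperyP S d, (leP S y w ∧ y ≠ w) ∧ (leP S w z ∧ w ≠ z)

/-- The poset `(AperyN S d, leN S)` is graded. -/
def gradedN (S : AddSubmonoid ℕ) (d : ℕ) : Prop :=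
  ∃ ρ : ℕ → ℕ, ∀ y z, coversN S d y z → ρ z = ρ y + 1

/-- The minimal system of generators of a submonoid `S ⊆ ℕ`: nonzero elements of `S`
that are not the sum of two nonzero elements of `S`. -/
def MSG (S : AddSubmonoid ℕ) : Set ℕ :=
  {x | x ∈ S ∧ x ≠ 0 ∧ ¬ ∃ u v : ℕ, u ∈ S ∧ v ∈ S ∧ u ≠ 0 ∧ v ≠ 0 ∧ x = u + v}

/-- The `s`-fold iterated sumset of `A ⊆ ℕ` (with `0A = {0}`). -/
def sumsetN (s : ℕ) (A : Set ℕ) : Set ℕ :=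
  {x | ∃ l : List ℕ, l.length = s ∧ (∀ b ∈ l, b ∈ A) ∧ l.sum = x}

section Counting

open Finset in
theorem sum_ncard_inter_eq_ncard_iff {α : Type*} {P : Set α} (hP : P.Finite) (T : ℕ → Set α)
    (N : ℕ) (hcov : ∀ y ∈ P, ∃ s ≤ N, y ∈ T s) :
    ∑ s ∈ range (N + 1), (P ∩ T s).ncard = P.ncard ↔
      ∀ y ∈ P, ∀ s ≤ N, ∀ t ≤ N, y ∈ T s → y ∈ T t → s = t := by
  classical
  have hcount : ∑ s ∈ range (N + 1), (P ∩ T s).ncard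
      = ∑ y ∈ hP.toFinset, #{s ∈ range (N + 1) | y ∈ T s} := by
    have h := sum_card_bipartiteAbove_eq_sum_card_bipartiteBelow
      (s := hP.toFinset) (t := range (N + 1)) (fun y s => y ∈ T s)
    simp only [bipartiteAbove, bipartiteBelow] at h
    rw [h]
    refine sum_congr rfl fun s _ => ?_
    rw [← Set.ncard_coe_finset]
    congr 1
    ext y
    simp
  have hpos : ∀ y ∈ hP.toFinset, 1 ≤ #{s ∈ range (N + 1) | y ∈ T s} := by
    intro y hy
    obtain ⟨s, hs, hys⟩ := hcov y (hP.mem_toFinset.1 hy)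
    exact card_pos.2 ⟨s, by simp [hys]; omega⟩
  have hcard : P.ncard = ∑ _y ∈ hP.toFinset, 1 := by
    rw [Set.ncard_eq_toFinset_card P hP, card_eq_sum_ones]
  rw [hcount, hcard, eq_comm, sum_eq_sum_iff_of_le hpos]
  refine ⟨fun h y hy s hs t ht hys hyt => ?_, fun h y hy => ?_⟩
  · have h1 := (h y (hP.mem_toFinset.2 hy)).ge
    exact card_le_one.1 h1 s (by simp [hys]; omega) t (by simp [hyt]; omega)
  · refine le_antisymm (hpos y hy) (card_le_one.2 fun s hs t ht => ?_)
    simp only [mem_filter, mem_range] at hs ht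
    exact h y (hP.mem_toFinset.1 hy) s (by omega) t (by omega) hs.2 ht.2

end Counting

section Apery

variable {S : AddSubmonoid ℕ} {d : ℕ}

theorem AperyN.left_of_add {y s : ℕ} (h : y + s ∈ AperyN S d) (hy : y ∈ S) (hs : s ∈ S) :
    y ∈ AperyN S d :=
  ⟨hy, fun ⟨t, ht, hyt⟩ => h.2 ⟨t + s, S.add_mem ht hs, by omega⟩⟩

theorem AperyN.right_of_add {y s : ℕ} (h : y + s ∈ AperyN S d) (hy : y ∈ S) (hs : s ∈ S) :
    s ∈ AperyN S d :=
  AperyN.left_of_add (add_comm y s ▸ h) hs hy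

theorem AperyN.ne {y : ℕ} (h : y ∈ AperyN S d) : y ≠ d :=
  fun hy => h.2 ⟨0, S.zero_mem, by omega⟩

theorem AperyN.injOn_mod (hdS : d ∈ S) : Set.InjOn (· % d) (AperyN S d) := by
  have key : ∀ y ∈ AperyN S d, ∀ z ∈ AperyN S d, y % d = z % d → ¬ y < z := by
    intro y hy z hz hyz hlt
    obtain ⟨k, hk⟩ := (Nat.modEq_iff_dvd' hlt.le).1 hyz
    cases k with
    | zero => omega
    | succ k =>
      refine hz.2 ⟨y + k • d, S.add_mem hy.1 (S.nsmul_mem hdS k), ?_⟩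
      rw [smul_eq_mul, add_assoc, mul_comm k, ← Nat.mul_succ, Nat.succ_eq_add_one]
      omega
  intro y hy z hz hyz
  exact le_antisymm (not_lt.1 (key z hz y hy hyz.symm)) (not_lt.1 (key y hy z hz hyz))

theorem AperyN.finite (hd : 0 < d) (hdS : d ∈ S) : (AperyN S d).Finite :=
  Set.Finite.of_injOn (t := Set.Iio d) (fun y _ => Nat.mod_lt y hd) (injOn_mod hdS)
    (Set.finite_Iio d)

theorem AperyN.ncard_eq (hd : 0 < d) (hdS : d ∈ S) (hS : ∃ m, ∀ x ≥ m, x ∈ S) :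
    (AperyN S d).ncard = d := by
  classical
  have himage : (· % d) '' AperyN S d = Set.Iio d := by
    refine Set.Subset.antisymm ?_ fun r (hr : r < d) => ?_
    · rintro _ ⟨y, -, rfl⟩
      exact Nat.mod_lt y hd
    · obtain ⟨m, hm⟩ := hS
      have hex : ∃ x, x ∈ S ∧ x % d = r :=
        ⟨r + d * m, hm _ (by nlinarith), by rw [Nat.add_mul_mod_self_left, Nat.mod_eq_of_lt hr]⟩
      refine ⟨Nat.find hex, ⟨(Nat.find_spec hex).1, fun ⟨s, hs, hxs⟩ => ?_⟩,
        (Nat.find_spec hex).2⟩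
      refine Nat.find_min hex (m := s) (by omega) ⟨hs, ?_⟩
      rw [← (Nat.find_spec hex).2, hxs, Nat.add_mod_right]
  rw [← (injOn_mod hdS).ncard_image, himage]
  simp [← Finset.coe_Iio, Set.ncard_coe_finset]

theorem exists_list_MSG_sum_eq {x : ℕ} (hx : x ∈ S) :
    ∃ l : List ℕ, (∀ b ∈ l, b ∈ MSG S) ∧ l.sum = x := by
  induction x using Nat.strong_induction_on with
  | _ x ih =>
    by_cases h0 : x = 0
    · exact ⟨[], by simp, by simp [h0]⟩
    by_cases hM : x ∈ MSG S
    · exact ⟨[x], by simpa using hM, by simp⟩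
    have hdec : ∃ u v : ℕ, u ∈ S ∧ v ∈ S ∧ u ≠ 0 ∧ v ≠ 0 ∧ x = u + v := by
      by_contra hdec
      exact hM ⟨hx, h0, hdec⟩
    obtain ⟨u, v, hu, hv, hu0, hv0, rfl⟩ := hdec
    obtain ⟨l, hl, hls⟩ := ih u (by omega) hu
    obtain ⟨k, hk, hks⟩ := ih v (by omega) hv
    refine ⟨l ++ k, fun b hb => ?_, by simp [hls, hks]⟩
    exact (List.mem_append.1 hb).elim (hl b) (hk b)

theorem list_sum_mem_of_MSG {l : List ℕ} (hl : ∀ b ∈ l, b ∈ MSG S) : l.sum ∈ S :=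
  S.list_sum_mem fun b hb => (hl b hb).1

theorem mem_MSG_of_list_sum_mem_AperyN {l : List ℕ} (hl : ∀ b ∈ l, b ∈ MSG S)
    (hsum : l.sum ∈ AperyN S d) : ∀ b ∈ l, b ∈ MSG S \ {d} := by
  intro b hb
  have hperm := (List.perm_cons_erase hb).sum_eq
  rw [List.sum_cons] at hperm
  rw [hperm] at hsum
  refine ⟨hl b hb, AperyN.ne (AperyN.left_of_add hsum (hl b hb).1 ?_)⟩
  exact list_sum_mem_of_MSG fun c hc => hl c (List.mem_of_mem_erase hc)

theorem coversN_iff {y z : ℕ} :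
    coversN S d y z ↔ y ∈ S ∧ z ∈ AperyN S d ∧ ∃ b ∈ MSG S, z = y + b := by
  constructor
  · rintro ⟨hy, hz, ⟨⟨s, hs, rfl⟩, hne⟩, hbtw⟩
    refine ⟨hy.1, hz, s, ⟨hs, by omega, ?_⟩, rfl⟩
    rintro ⟨u, v, hu, hv, hu0, hv0, rfl⟩
    rw [← add_assoc] at hz
    exact hbtw ⟨y + u, AperyN.left_of_add hz (S.add_mem hy.1 hu) hv, ⟨⟨u, hu, rfl⟩, by omega⟩,
      ⟨v, hv, by omega⟩, by omega⟩
  · rintro ⟨hy, hz, b, hb, rfl⟩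
    refine ⟨AperyN.left_of_add hz hy hb.1, hz, ⟨⟨b, hb.1, rfl⟩, by have := hb.2.1; omega⟩, ?_⟩
    rintro ⟨w, -, ⟨⟨u, hu, rfl⟩, hu0⟩, ⟨v, hv, hbv⟩, hv0⟩
    exact hb.2.2 ⟨u, v, hu, hv, by omega, by omega, by omega⟩

theorem rank_list_sum {ρ : ℕ → ℕ} (hρ : ∀ y z, coversN S d y z → ρ z = ρ y + 1)
    {l : List ℕ} (hl : ∀ b ∈ l, b ∈ MSG S) (hsum : l.sum ∈ AperyN S d) :
    ρ l.sum = ρ 0 + l.length := by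
  induction l with
  | nil => simp
  | cons b l ih =>
    have hb : b ∈ MSG S := hl b (by simp)
    have hl' : ∀ c ∈ l, c ∈ MSG S := fun c hc => hl c (by simp [hc])
    have hlS := list_sum_mem_of_MSG hl'
    rw [List.sum_cons] at hsum ⊢
    rw [hρ l.sum _ (coversN_iff.2 ⟨hlS, hsum, b, hb, add_comm _ _⟩),
      ih hl' (AperyN.right_of_add hsum hb.1 hlS), List.length_cons, add_assoc]

theorem exists_mem_sumsetN_of_mem_AperyN {y : ℕ} (hy : y ∈ AperyN S d) :
    ∃ s, y ∈ sumsetN s (MSG S \ {d}) := by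
  obtain ⟨l, hl, rfl⟩ := exists_list_MSG_sum_eq hy.1
  exact ⟨l.length, l, rfl, mem_MSG_of_list_sum_mem_AperyN hl hy, rfl⟩

theorem gradedN_iff_sumsetN_unique :
    gradedN S d ↔ ∀ y ∈ AperyN S d, ∀ s t, y ∈ sumsetN s (MSG S \ {d}) →
      y ∈ sumsetN t (MSG S \ {d}) → s = t := by
  constructor
  · rintro ⟨ρ, hρ⟩ y hy s t ⟨l, rfl, hl, rfl⟩ ⟨k, rfl, hk, hkl⟩
    have h1 := rank_list_sum hρ (fun b hb => (hl b hb).1) hy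
    have h2 := rank_list_sum hρ (fun b hb => (hk b hb).1) (hkl ▸ hy)
    rw [hkl] at h2
    omega
  · intro huniq
    choose! ρ hρ using fun y (hy : y ∈ AperyN S d) => exists_mem_sumsetN_of_mem_AperyN hy
    refine ⟨ρ, fun y z hyz => ?_⟩
    have hy := hyz.1
    obtain ⟨hyS, hz, b, hb, rfl⟩ := coversN_iff.1 hyz
    refine huniq _ hz _ _ (hρ _ hz) ?_
    obtain ⟨l, hlen, hl, hls⟩ := hρ y hy
    have hbd : b ≠ d := AperyN.ne (AperyN.right_of_add hz hyS hb.1)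
    refine ⟨b :: l, by simp [hlen], ?_, by rw [List.sum_cons, hls, add_comm]⟩
    rintro c (_ | ⟨_, hc⟩)
    exacts [⟨hb, hbd⟩, hl c hc]

end Apery

theorem Smon1_eventually_mem {n : ℕ} {a : ℕ → ℕ} (hgcd : Finset.gcd (Finset.Icc 1 n) a = 1) :
    ∃ m, ∀ x ≥ m, x ∈ Smon1 n a := by
  obtain ⟨m, hm⟩ := Nat.exists_mem_closure_of_ge {x | ∃ i, 1 ≤ i ∧ i ≤ n ∧ x = a i}
  refine ⟨m, fun x hx => hm x hx ?_⟩
  have hone : Nat.setGcd {x | ∃ i, 1 ≤ i ∧ i ≤ n ∧ x = a i} ∣ 1 := by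
    refine (Finset.dvd_gcd fun i hi => Nat.setGcd_dvd_of_mem ?_).trans hgcd.dvd
    exact ⟨i, (Finset.mem_Icc.1 hi).1, (Finset.mem_Icc.1 hi).2, rfl⟩
  exact hone.trans (one_dvd x)

/-- Corollary 1.5: with `A′₁ = MSG(S₁) ∖ {a n}`, `Ap₁⁽ˢ⁾ = Ap₁ ∩ s·A′₁` and
`N = max{s : Ap₁⁽ˢ⁾ ≠ ∅}`, the poset `(Ap₁, ≤₁)` is graded iff
`Σ_{s=0}^{N} |Ap₁⁽ˢ⁾| = d`. -/
theorem stmt7 (n d : ℕ) (a : ℕ → ℕ) (hd : 0 < d) (hn : 2 ≤ n)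
    (h0 : a 0 = 0) (han : a n = d)
    (hmono : ∀ i j, i < j → j ≤ n → a i < a j)
    (hgcd : Finset.gcd (Finset.Icc 1 n) a = 1)
    (N : ℕ)
    (hN1 : (AperyN (Smon1 n a) d ∩ sumsetN N (MSG (Smon1 n a) \ {a n})).Nonempty)
    (hN2 : ∀ s : ℕ,
      (AperyN (Smon1 n a) d ∩ sumsetN s (MSG (Smon1 n a) \ {a n})).Nonempty → s ≤ N) :
    gradedN (Smon1 n a) d ↔
      (∑ s ∈ Finset.range (N + 1),
        (AperyN (Smon1 n a) d ∩ sumsetN s (MSG (Smon1 n a) \ {a n})).ncard) = d := by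
  have hdS : d ∈ Smon1 n a := AddSubmonoid.subset_closure ⟨n, by omega, le_rfl, han.symm⟩
  have hcard := AperyN.ncard_eq hd hdS (Smon1_eventually_mem hgcd)
  rw [han] at hN2 ⊢
  have hbound : ∀ y ∈ AperyN (Smon1 n a) d, ∀ s,
      y ∈ sumsetN s (MSG (Smon1 n a) \ {d}) → s ≤ N := fun y hy s hs => hN2 s ⟨y, hy, hs⟩
  have hsum := sum_ncard_inter_eq_ncard_iff (AperyN.finite hd hdS)
    (fun s => sumsetN s (MSG (Smon1 n a) \ {d})) N fun y hy =>
      (exists_mem_sumsetN_of_mem_AperyN hy).imp fun s hs => ⟨hbound y hy s hs, hs⟩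
  rw [hcard] at hsum
  rw [gradedN_iff_sumsetN_unique, hsum]
  exact ⟨fun h y hy s _ t _ hs ht => h y hy s t hs ht, fun h y hy s t hs ht =>
    h y hy s (hbound y hy s hs) t (hbound y hy t ht) hs ht⟩
end

section
/- Step in the proof of Proposition 5.2: Assume that (r_i, t_{d−i}) ∈ S for all i = 1, …, d − 1 (the arithmetically Cohen–Macaulay criterion) and that d does not divide F(S_1) + F(S_2). Then there exist y ∈ S_1 and z ∈ S_2 such that (F(S_1) + d, z) ∈ AP_S and (y, F(S_2) + d) ∈ AP_S; these two elements are distinct and each is a maximal element of the poset (AP_S, ≤_S). In particular, (AP_S, ≤_S) has no maximum element. -/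
/-- Membership of an integer in (the image in `ℤ` of) a submonoid of `ℕ`. -/
def memZ (S : AddSubmonoid ℕ) (x : ℤ) : Prop := ∃ y : ℕ, y ∈ S ∧ (y : ℤ) = x

theorem exists_aperyN_add_mul {S : AddSubmonoid ℕ} {d : ℕ} (hd : 0 < d) (u : ℕ) (hu : u ∈ S) :
    ∃ p ∈ AperyN S d, ∃ k, u = p + k * d := by
  induction u using Nat.strong_induction_on with
  | _ u ih =>
    by_cases h : ∃ s ∈ S, u = s + d
    · obtain ⟨s, hs, rfl⟩ := h
      obtain ⟨p, hp, k, hk⟩ := ih s (by omega) hs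
      exact ⟨p, hp, k + 1, by rw [hk]; ring⟩
    · exact ⟨u, ⟨hu, h⟩, 0, by simp⟩

theorem mem_of_mem_SmonH {n d : ℕ} {a : ℕ → ℕ} (h0 : a 0 = 0) (han : a n = d)
    (had : ∀ i ≤ n, a i ≤ d) (p : ℕ × ℕ) (hp : p ∈ SmonH n d a) :
    p.1 ∈ Smon1 n a ∧ p.2 ∈ Smon2 n d a ∧ d ∣ p.1 + p.2 := by
  induction hp using AddSubmonoid.closure_induction with
  | mem x hx =>
    obtain ⟨i, hi, rfl⟩ := hx
    refine ⟨?_, ?_, ?_⟩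
    · rcases Nat.eq_zero_or_pos i with rfl | h
      · simp [h0]
      · exact AddSubmonoid.subset_closure ⟨i, h, hi, rfl⟩
    · rcases hi.eq_or_lt with rfl | h
      · simp [han]
      · exact AddSubmonoid.subset_closure ⟨i, h, rfl⟩
    · have := had i hi
      simp [Nat.add_sub_cancel' this]
  | zero => simp
  | add x y _ _ hx hy =>
    refine ⟨add_mem hx.1 hy.1, add_mem hx.2.1 hy.2.1, ?_⟩
    have := dvd_add hx.2.2 hy.2.2
    simpa [add_add_add_comm] using this

theorem mem_aperyP_iff {S : AddSubmonoid (ℕ × ℕ)} {S₁ S₂ : AddSubmonoid ℕ} {d : ℕ}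
    (hS : ∀ u v, (u, v) ∈ S ↔ u ∈ S₁ ∧ v ∈ S₂ ∧ d ∣ u + v) (u v : ℕ) :
    (u, v) ∈ AperyP S d ↔ u ∈ AperyN S₁ d ∧ v ∈ AperyN S₂ d ∧ d ∣ u + v := by
  constructor
  · rintro ⟨h, hv, hu⟩
    obtain ⟨hu', hv', hdvd⟩ := (hS u v).1 h
    refine ⟨⟨hu', ?_⟩, ⟨hv', ?_⟩, hdvd⟩
    · rintro ⟨s, hs, rfl⟩
      refine hu ⟨(s, v), (hS _ _).2 ⟨hs, hv', ?_⟩, by simp⟩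
      rwa [add_right_comm, Nat.dvd_add_self_right] at hdvd
    · rintro ⟨s, hs, rfl⟩
      refine hv ⟨(u, s), (hS _ _).2 ⟨hu', hs, ?_⟩, by simp⟩
      rwa [← add_assoc, Nat.dvd_add_self_right] at hdvd
  · rintro ⟨⟨hu, hu'⟩, ⟨hv, hv'⟩, hdvd⟩
    refine ⟨(hS u v).2 ⟨hu, hv, hdvd⟩, ?_, ?_⟩
    · rintro ⟨⟨x, y⟩, hs, h⟩
      simp only [Prod.mk_add_mk, Prod.mk.injEq] at h
      exact hv' ⟨y, ((hS x y).1 hs).2.1, h.2⟩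
    · rintro ⟨⟨x, y⟩, hs, h⟩
      simp only [Prod.mk_add_mk, Prod.mk.injEq] at h
      exact hu' ⟨x, ((hS x y).1 hs).1, h.1⟩

theorem frobenius_add_mem_aperyN {S : AddSubmonoid ℕ} {d : ℕ} (hd : 0 < d) {F : ℤ}
    (hF : IsGreatest {x : ℤ | ¬ memZ S x} F) :
    ((F + d).toNat : ℤ) = F + d ∧ (F + d).toNat ∈ AperyN S d ∧
      ∀ u ∈ AperyN S d, u ≤ (F + d).toNat := by
  have hmem : memZ S (F + d) := by
    by_contra h
    have := hF.2 h
    omega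
  obtain ⟨y, hy, hyF⟩ := hmem
  have hy' : (F + d).toNat = y := by omega
  rw [hy']
  refine ⟨hyF, ⟨hy, ?_⟩, ?_⟩
  · rintro ⟨s, hs, rfl⟩
    exact hF.1 ⟨s, hs, by push_cast at hyF; omega⟩
  · rintro u ⟨-, hu⟩
    have : (u : ℤ) - d ≤ F := hF.2 fun ⟨s, hs, h⟩ => hu ⟨s, hs, by omega⟩
    omega

theorem exists_dvd_add {d : ℕ} (hd : 0 < d) {A : Set ℕ} {t : ℕ → ℕ}
    (ht : ∀ i, i < d → t i ∈ A ∧ t i % d = i) (u : ℕ) : ∃ z ∈ A, d ∣ u + z := by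
  have hlt := Nat.mod_lt u hd
  obtain ⟨hz, hm⟩ := ht ((d - u % d) % d) (Nat.mod_lt _ hd)
  refine ⟨_, hz, Nat.dvd_of_mod_eq_zero ?_⟩
  rw [Nat.add_mod, hm, Nat.add_mod_mod, Nat.add_sub_cancel' hlt.le, Nat.mod_self]

theorem eq_of_dvd_add {d : ℕ} (hd : 0 < d) {A : Set ℕ} {t : ℕ → ℕ}
    (ht : ∀ i, i < d → ∀ y ∈ A, y % d = i → y = t i) {u y z : ℕ} (hy : y ∈ A) (hz : z ∈ A)
    (huy : d ∣ u + y) (huz : d ∣ u + z) : y = z := by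
  have h : y ≡ z [MOD d] :=
    Nat.ModEq.add_left_cancel' u
      (((Nat.modEq_zero_iff_dvd).2 huy).trans ((Nat.modEq_zero_iff_dvd).2 huz).symm)
  rw [ht _ (Nat.mod_lt y hd) y hy rfl, ht _ (Nat.mod_lt y hd) z hz h.symm]

theorem mem_SmonH_iff {n d : ℕ} {a : ℕ → ℕ} (hd : 0 < d) (h0 : a 0 = 0) (han : a n = d)
    (had : ∀ i ≤ n, a i ≤ d) {r t : ℕ → ℕ}
    (hr : ∀ i, i < d → ∀ y ∈ AperyN (Smon1 n a) d, y % d = i → y = r i)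
    (ht : ∀ i, i < d → ∀ y ∈ AperyN (Smon2 n d a) d, y % d = i → y = t i)
    (hACM : ∀ i, 1 ≤ i → i ≤ d - 1 → ((r i, t (d - i)) : ℕ × ℕ) ∈ SmonH n d a) (u v : ℕ) :
    (u, v) ∈ SmonH n d a ↔ u ∈ Smon1 n a ∧ v ∈ Smon2 n d a ∧ d ∣ u + v := by
  refine ⟨fun h => mem_of_mem_SmonH h0 han had _ h, ?_⟩
  rintro ⟨hu, hv, hdvd⟩
  obtain ⟨p, hp, k, rfl⟩ := exists_aperyN_add_mul hd u hu
  obtain ⟨q, hq, l, rfl⟩ := exists_aperyN_add_mul hd v hv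
  have hd1 : ((d, 0) : ℕ × ℕ) ∈ SmonH n d a :=
    AddSubmonoid.subset_closure ⟨n, le_rfl, by simp [han]⟩
  have hd2 : ((0, d) : ℕ × ℕ) ∈ SmonH n d a :=
    AddSubmonoid.subset_closure ⟨0, Nat.zero_le n, by simp [h0]⟩
  have hpq : d ∣ p + q := by
    rw [add_add_add_comm, ← add_mul] at hdvd
    exact (Nat.dvd_add_left (Dvd.intro_left _ rfl)).1 hdvd
  have hmem : (p, q) ∈ SmonH n d a := by
    have hplt := Nat.mod_lt p hd
    have hpr := hr _ hplt p hp rfl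
    rcases Nat.eq_zero_or_pos (p % d) with hp0 | hp0
    · have zero_mem_aperyN (S : AddSubmonoid ℕ) : 0 ∈ AperyN S d :=
        ⟨S.zero_mem, fun ⟨s, _, h⟩ => by omega⟩
      have hq0 : q % d = 0 :=
        Nat.mod_eq_zero_of_dvd ((Nat.dvd_add_right (Nat.dvd_of_mod_eq_zero hp0)).1 hpq)
      have hp' : p = 0 := (hr 0 hd p hp hp0).trans
        (hr 0 hd 0 (zero_mem_aperyN _) (Nat.zero_mod d)).symm
      have hq' : q = 0 := (ht 0 hd q hq hq0).trans
        (ht 0 hd 0 (zero_mem_aperyN _) (Nat.zero_mod d)).symm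
      rw [hp', hq']
      exact zero_mem _
    · have hqm : q % d = d - p % d := by
        have hqlt := Nat.mod_lt q hd
        have h := Nat.mod_eq_zero_of_dvd hpq
        rw [Nat.add_mod] at h
        obtain ⟨c, hc⟩ := Nat.dvd_of_mod_eq_zero h
        have hc1 : c = 1 := by
          have h1 : c < 2 := by
            by_contra! hge
            have := Nat.mul_le_mul_left d hge
            omega
          have h2 : c ≠ 0 := by rintro rfl; omega
          omega
        subst hc1
        omega
      rw [hpr, ht (d - p % d) (by omega) q hq hqm]
      exact hACM _ hp0 (by omega)
  have := add_mem hmem (add_mem (nsmul_mem hd1 k) (nsmul_mem hd2 l))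
  simpa using this

/-- Step in the proof of Proposition 5.2: under the Cohen–Macaulay criterion, if `d` does
not divide `F(S₁) + F(S₂)`, then there exist `y ∈ S₁` and `z ∈ S₂` with
`(F(S₁) + d, z)` and `(y, F(S₂) + d)` two distinct maximal elements of `(AP_S, ≤_S)`,
and the poset has no maximum. -/
theorem stmt15 (n d : ℕ) (a : ℕ → ℕ) (hd : 0 < d) (hn : 2 ≤ n)
    (h0 : a 0 = 0) (han : a n = d)
    (hmono : ∀ i j, i < j → j ≤ n → a i < a j)
    (hgcd : Finset.gcd (Finset.Icc 1 n) a = 1)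
    (r t : ℕ → ℕ)
    (hr : ∀ i, i < d → (r i ∈ AperyN (Smon1 n a) d ∧ r i % d = i ∧
      ∀ y ∈ AperyN (Smon1 n a) d, y % d = i → y = r i))
    (ht : ∀ i, i < d → (t i ∈ AperyN (Smon2 n d a) d ∧ t i % d = i ∧
      ∀ y ∈ AperyN (Smon2 n d a) d, y % d = i → y = t i))
    (hACM : ∀ i, 1 ≤ i → i ≤ d - 1 → ((r i, t (d - i)) : ℕ × ℕ) ∈ SmonH n d a)
    (F1 F2 : ℤ)
    (hF1 : IsGreatest {x : ℤ | ¬ memZ (Smon1 n a) x} F1)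
    (hF2 : IsGreatest {x : ℤ | ¬ memZ (Smon2 n d a) x} F2)
    (hndvd : ¬ (d : ℤ) ∣ F1 + F2) :
    (∃ y ∈ Smon1 n a, ∃ z ∈ Smon2 n d a,
      (((F1 + d).toNat, z) ∈ AperyP (SmonH n d a) d) ∧
      ((y, (F2 + d).toNat) ∈ AperyP (SmonH n d a) d) ∧
      (((F1 + d).toNat, z) : ℕ × ℕ) ≠ (y, (F2 + d).toNat) ∧
      (∀ w ∈ AperyP (SmonH n d a) d,
        leP (SmonH n d a) ((F1 + d).toNat, z) w → w = ((F1 + d).toNat, z)) ∧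
      (∀ w ∈ AperyP (SmonH n d a) d,
        leP (SmonH n d a) (y, (F2 + d).toNat) w → w = (y, (F2 + d).toNat)))
    ∧
    ¬ ∃ m ∈ AperyP (SmonH n d a) d,
        ∀ y ∈ AperyP (SmonH n d a) d, leP (SmonH n d a) y m := by
  have had : ∀ i ≤ n, a i ≤ d := fun i hi => by
    rcases hi.eq_or_lt with rfl | h
    · exact han.le
    · exact han ▸ (hmono i n h le_rfl).le
  have hS := mem_SmonH_iff hd h0 han had (fun i hi => (hr i hi).2.2)
    (fun i hi => (ht i hi).2.2) hACM
  have hAP := mem_aperyP_iff hS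
  obtain ⟨hcast1, hA1, hmax1⟩ := frobenius_add_mem_aperyN hd hF1
  obtain ⟨hcast2, hA2, hmax2⟩ := frobenius_add_mem_aperyN hd hF2
  generalize (F1 + d).toNat = f1 at *
  generalize (F2 + d).toNat = f2 at *
  obtain ⟨z, hz, hfz⟩ := exists_dvd_add hd (fun i hi => ⟨(ht i hi).1, (ht i hi).2.1⟩) f1
  obtain ⟨y, hy, hfy⟩ := exists_dvd_add hd (fun i hi => ⟨(hr i hi).1, (hr i hi).2.1⟩) f2
  rw [add_comm] at hfy
  have hm1 : (f1, z) ∈ AperyP (SmonH n d a) d := (hAP _ _).2 ⟨hA1, hz, hfz⟩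
  have hm2 : (y, f2) ∈ AperyP (SmonH n d a) d := (hAP _ _).2 ⟨hy, hA2, hfy⟩
  have hne : ((f1, z) : ℕ × ℕ) ≠ (y, f2) := by
    intro h
    obtain ⟨-, rfl⟩ := Prod.mk.inj h
    apply hndvd
    obtain ⟨c, hc⟩ := hfz
    refine ⟨c - 2, ?_⟩
    have hc' : (f1 : ℤ) + z = d * c := by exact_mod_cast hc
    linear_combination hc' - hcast1 - hcast2
  have hM1 : ∀ w ∈ AperyP (SmonH n d a) d, leP (SmonH n d a) (f1, z) w → w = (f1, z) := by
    rintro ⟨u, v⟩ hw ⟨⟨s1, s2⟩, -, h⟩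
    obtain ⟨hu, hv, huv⟩ := (hAP _ _).1 hw
    obtain ⟨h1, -⟩ := Prod.mk.inj h
    have hle := hmax1 u hu
    obtain rfl : u = f1 := le_antisymm hle (h1 ▸ Nat.le_add_right _ _)
    rw [eq_of_dvd_add hd (fun i hi => (ht i hi).2.2) hv hz huv hfz]
  have hM2 : ∀ w ∈ AperyP (SmonH n d a) d, leP (SmonH n d a) (y, f2) w → w = (y, f2) := by
    rintro ⟨u, v⟩ hw ⟨⟨s1, s2⟩, -, h⟩
    obtain ⟨hu, hv, huv⟩ := (hAP _ _).1 hw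
    obtain ⟨-, h2⟩ := Prod.mk.inj h
    have hle := hmax2 v hv
    obtain rfl : v = f2 := le_antisymm hle (h2 ▸ Nat.le_add_right _ _)
    rw [add_comm] at huv hfy
    rw [eq_of_dvd_add hd (fun i hi => (hr i hi).2.2) hu hy huv hfy]
  refine ⟨⟨y, hy.1, z, hz.1, hm1, hm2, hne, hM1, hM2⟩, ?_⟩
  rintro ⟨m, hm, hle⟩
  exact hne ((hM1 m hm (hle _ hm1)).symm.trans (hM2 m hm (hle _ hm2)))
end
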